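/- arXiv:1708.06093 — 3 statements merged into one kernel-verified Lean document; each statement's English description precedes it below -/
import Mathlib

section
/- Let T₁ and T₂ be two commuting transitive continuous maps on a compact metric space X (T₁∘T₂ = T₂∘T₁). Then G_k(T₁) = G_k(T₂) for every k ≥ 1. -/
open MeasureTheory Filter

noncomputable section

/-- `lam` is an eigenvalue of `T` realized by a nonzero continuous eigenfunction. -/
def IsTopEigenvalue {X : Type*} [TopologicalSpace X] (T : X → X) (lam : ℂ) : Prop :=
  ∃ g : X → ℂ, Continuous g ∧ g ≠ 0 ∧ ∀ x, g (T x) = lam * g x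

/-- Continuous quasi-eigenfunctions of order `k` (Hahn–Parry). -/
def Gquasi {X : Type*} [TopologicalSpace X] (T : X → X) : ℕ → Set (X → ℂ)
  | 0 => {f | ∃ lam : ℂ, IsTopEigenvalue T lam ∧ ∀ x, f x = lam}
  | (k + 1) => {f | Continuous f ∧ (∀ x, ‖f x‖ = 1) ∧
      (fun x => f (T x) * (starRingEnd ℂ) (f x)) ∈ Gquasi T k}

section QuasiEigenfunctions

variable {X : Type*} [TopologicalSpace X]

open ComplexConjugate

/-- A continuous invariant function of a transitive map is constant. -/
theorem eq_of_invariant_of_dense_orbit {Y : Type*} [TopologicalSpace Y] [T2Space Y]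
    {T : X → X} {f : X → Y} (hf : Continuous f) (hinv : ∀ x, f (T x) = f x)
    {x₀ : X} (hx₀ : Dense (Set.range fun n : ℕ => T^[n] x₀)) (x : X) : f x = f x₀ := by
  refine congrFun (hf.ext_on hx₀ continuous_const (g := fun _ => f x₀) ?_) x
  rintro _ ⟨n, rfl⟩
  induction n with
  | zero => rfl
  | succ n ih => simpa only [Function.iterate_succ_apply', hinv] using ih

/-- An order-one quasi-eigenfunction is a unimodular continuous eigenfunction. -/
theorem mem_Gquasi_one_iff [Nonempty X] {T : X → X} {f : X → ℂ} :
    f ∈ Gquasi T 1 ↔ Continuous f ∧ (∀ x, ‖f x‖ = 1) ∧ ∃ c : ℂ, ∀ x, f (T x) * conj (f x) = c := by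
  refine ⟨fun ⟨hf, hn, c, _, hc⟩ => ⟨hf, hn, c, hc⟩, fun ⟨hf, hn, c, hc⟩ =>
    ⟨hf, hn, c, ⟨f, hf, ?_, fun x => ?_⟩, hc⟩⟩
  · rintro rfl
    simpa using hn (Classical.arbitrary X)
  · rw [← hc x, mul_assoc, Complex.conj_mul', hn x]
    simp

theorem norm_mul_conj_eq_one {a b : ℂ} (ha : ‖a‖ = 1) (hb : ‖b‖ = 1) : ‖a * conj b‖ = 1 := by
  simp [ha, hb]

/-- The multiplicative coboundaries of a unimodular function along two commuting maps satisfy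
the same mixed second-difference relation. -/
theorem mixed_coboundary {Y : Type*} {S T : Y → Y} (hcomm : ∀ y, S (T y) = T (S y))
    (f : Y → ℂ) (x : Y) :
    f (S (T x)) * conj (f (T x)) * conj (f (S x) * conj (f x)) =
      f (T (S x)) * conj (f (S x)) * conj (f (T x) * conj (f x)) := by
  rw [hcomm, map_mul, map_mul]
  ring

theorem Gquasi_one_subset_of_commute {S T : X → X} (hS : Continuous S)
    {x₀ : X} (hx₀ : Dense (Set.range fun n : ℕ => T^[n] x₀))
    (hcomm : ∀ x, S (T x) = T (S x)) : Gquasi T 1 ⊆ Gquasi S 1 := by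
  have : Nonempty X := ⟨x₀⟩
  intro f hf
  obtain ⟨hfc, hfn, c, hc⟩ := mem_Gquasi_one_iff.1 hf
  have hcn : ‖c‖ = 1 := hc x₀ ▸ norm_mul_conj_eq_one (hfn _) (hfn _)
  refine mem_Gquasi_one_iff.2 ⟨hfc, hfn, f (S x₀) * conj (f x₀),
    eq_of_invariant_of_dense_orbit (T := T) (by fun_prop) (fun x => ?_) hx₀⟩
  have h := mixed_coboundary hcomm f x
  rw [hc, hc, Complex.mul_conj', hcn] at h
  have hn := norm_mul_conj_eq_one (hfn (S x)) (hfn x)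
  calc f (S (T x)) * conj (f (T x))
      = f (S (T x)) * conj (f (T x)) *
          (conj (f (S x) * conj (f x)) * (f (S x) * conj (f x))) := by
        rw [Complex.conj_mul', hn]; simp
    _ = f (S x) * conj (f x) := by rw [← mul_assoc, h]; simp

theorem Gquasi_add_two_subset_of_commute {S T : X → X} (hS : Continuous S)
    (hcomm : ∀ x, S (T x) = T (S x)) {k : ℕ} (hk : Gquasi T (k + 1) = Gquasi S (k + 1))
    (hlift : ∀ h : X → ℂ, Continuous h → (∀ x, ‖h x‖ = 1) →
      (fun x => h (T x) * conj (h x)) ∈ Gquasi S k → h ∈ Gquasi T (k + 1)) :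
    Gquasi T (k + 2) ⊆ Gquasi S (k + 2) := by
  rintro f ⟨hfc, hfn, hfg⟩
  refine ⟨hfc, hfn, hk ▸ hlift _ (by fun_prop)
    (fun x => norm_mul_conj_eq_one (hfn _) (hfn _)) ?_⟩
  rw [hk] at hfg
  simpa only [mixed_coboundary hcomm f] using hfg.2.2

theorem Gquasi_two_subset_of_commute [Nonempty X] {S T : X → X} (hS : Continuous S)
    (hcomm : ∀ x, S (T x) = T (S x)) (h1 : Gquasi T 1 = Gquasi S 1) :
    Gquasi T 2 ⊆ Gquasi S 2 :=
  Gquasi_add_two_subset_of_commute hS hcomm h1 fun _ hc hn ⟨c, _, h⟩ =>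
    mem_Gquasi_one_iff.2 ⟨hc, hn, c, h⟩

theorem Gquasi_add_three_subset_of_commute {S T : X → X} (hS : Continuous S)
    (hcomm : ∀ x, S (T x) = T (S x)) {k : ℕ} (hk : Gquasi T (k + 1) = Gquasi S (k + 1))
    (hk' : Gquasi T (k + 2) = Gquasi S (k + 2)) : Gquasi T (k + 3) ⊆ Gquasi S (k + 3) :=
  Gquasi_add_two_subset_of_commute hS hcomm hk' fun _ hc hn h => ⟨hc, hn, hk ▸ h⟩

end QuasiEigenfunctions

/-- Two commuting transitive continuous maps on a compact metric space have the same groups of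
continuous quasi-eigenfunctions of every order `k ≥ 1`. -/
theorem Gquasi_eq_of_commute
    {X : Type*} [MetricSpace X] [CompactSpace X]
    (T₁ T₂ : X → X) (h₁ : Continuous T₁) (h₂ : Continuous T₂)
    (htrans₁ : ∃ x : X, Dense (Set.range fun n : ℕ => T₁^[n] x))
    (htrans₂ : ∃ x : X, Dense (Set.range fun n : ℕ => T₂^[n] x))
    (hcomm : T₁ ∘ T₂ = T₂ ∘ T₁) (k : ℕ) (hk : 1 ≤ k) :
    Gquasi T₁ k = Gquasi T₂ k := by
  obtain ⟨x₁, hx₁⟩ := htrans₁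
  obtain ⟨x₂, hx₂⟩ := htrans₂
  have : Nonempty X := ⟨x₁⟩
  have h12 : ∀ x, T₁ (T₂ x) = T₂ (T₁ x) := congrFun hcomm
  have h21 : ∀ x, T₂ (T₁ x) = T₁ (T₂ x) := fun x => (h12 x).symm
  have hone : Gquasi T₁ 1 = Gquasi T₂ 1 :=
    (Gquasi_one_subset_of_commute h₂ hx₁ h21).antisymm (Gquasi_one_subset_of_commute h₁ hx₂ h12)
  obtain ⟨k, rfl⟩ := Nat.exists_eq_add_of_le' hk
  induction k using Nat.twoStepInduction with
  | zero => exact hone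
  | one =>
    exact (Gquasi_two_subset_of_commute h₂ h21 hone).antisymm
      (Gquasi_two_subset_of_commute h₁ h12 hone.symm)
  | more k ih ih' =>
    have e := ih (by omega)
    have e' := ih' (by omega)
    exact (Gquasi_add_three_subset_of_commute h₂ h21 e e').antisymm
      (Gquasi_add_three_subset_of_commute h₁ h12 e.symm e'.symm)
end
end

section
/- Let T be a continuous map on a compact metric space X and m ≥ 2 an integer. If both T and T^m are transitive, then G_k(T) = G_k(T^m) for every k ≥ 1. -/
open MeasureTheory Filter

noncomputable section

/-- The iterated cocycle sets starting from `{1}`: unimodular continuous functions that become `1`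
after `k` applications of `f ↦ (f ∘ T) · conj f`. -/
def unipotentFunctions {X : Type*} [TopologicalSpace X] (T : X → X) : ℕ → Set (X → ℂ)
  | 0 => {f | ∀ x, f x = 1}
  | (k + 1) => {f | Continuous f ∧ (∀ x, ‖f x‖ = 1) ∧
      (fun x => f (T x) * (starRingEnd ℂ) (f x)) ∈ unipotentFunctions T k}

lemma mul_conj_eq_one_of_norm_eq_one {z : ℂ} (hz : ‖z‖ = 1) : z * (starRingEnd ℂ) z = 1 := by
  simp [Complex.mul_conj, Complex.normSq_eq_norm_sq, hz]

namespace unipotentFunctions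

variable {X : Type*} [TopologicalSpace X] {T : X → X}

lemma mul_mem {k : ℕ} {f g : X → ℂ} (hf : f ∈ unipotentFunctions T k)
    (hg : g ∈ unipotentFunctions T k) : (fun x => f x * g x) ∈ unipotentFunctions T k := by
  induction k generalizing f g with
  | zero => intro x; simp [hf x, hg x]
  | succ k ih =>
    obtain ⟨hfc, hfn, hf⟩ := hf
    obtain ⟨hgc, hgn, hg⟩ := hg
    refine ⟨hfc.mul hgc, fun x => by simp [hfn, hgn], ?_⟩
    convert ih hf hg using 2 with x
    rw [map_mul]
    ring

lemma comp_mem (hT : Continuous T) {k : ℕ} {f : X → ℂ} (hf : f ∈ unipotentFunctions T k) :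
    (fun x => f (T x)) ∈ unipotentFunctions T k := by
  induction k generalizing f with
  | zero => exact fun x => hf (T x)
  | succ k ih => exact ⟨hf.1.comp hT, fun x => hf.2.1 (T x), ih hf.2.2⟩

lemma iterate_mul_conj_mem (hT : Continuous T) {k : ℕ} {f : X → ℂ} (hn : ∀ x, ‖f x‖ = 1)
    (hf : (fun x => f (T x) * (starRingEnd ℂ) (f x)) ∈ unipotentFunctions T k) (n : ℕ) :
    (fun x => f (T^[n + 1] x) * (starRingEnd ℂ) (f x)) ∈ unipotentFunctions T k := by
  induction n with
  | zero => exact hf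
  | succ n ih =>
    convert mul_mem (comp_mem hT ih) hf using 2 with x
    rw [Function.iterate_succ_apply T (n + 1) x]
    linear_combination -f (T^[n + 1] (T x)) * (starRingEnd ℂ) (f x) *
      mul_conj_eq_one_of_norm_eq_one (hn (T x))

lemma subset_iterate (hT : Continuous T) (n k : ℕ) :
    unipotentFunctions T k ⊆ unipotentFunctions T^[n + 1] k := by
  induction k with
  | zero => exact subset_rfl
  | succ k ih => exact fun f hf => ⟨hf.1, hf.2.1, ih (iterate_mul_conj_mem hT hf.2.1 hf.2.2 n)⟩

lemma mem_one_iff {f : X → ℂ} : f ∈ unipotentFunctions T 1 ↔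
    Continuous f ∧ (∀ x, ‖f x‖ = 1) ∧ ∀ x, f (T x) = f x := by
  refine and_congr_right fun _ => and_congr_right fun hn => forall_congr' fun x => ?_
  have h := mul_conj_eq_one_of_norm_eq_one (hn x)
  constructor
  · intro h'
    linear_combination f x * h' - f (T x) * h
  · intro h'
    change f (T x) * _ = 1
    rw [h', h]

/-- An invariant continuous function of a transitive system is constant. -/
lemma exists_const_of_mem_one (htrans : ∃ x : X, Dense (Set.range fun n : ℕ => T^[n] x))
    {f : X → ℂ} (hf : f ∈ unipotentFunctions T 1) : ∃ c, ∀ x, f x = c := by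
  obtain ⟨hfc, -, hf⟩ := mem_one_iff.1 hf
  obtain ⟨x₀, hx₀⟩ := htrans
  refine ⟨f x₀, congrFun (hfc.ext_on hx₀ continuous_const ?_)⟩
  rintro _ ⟨n, rfl⟩
  induction n with
  | zero => rfl
  | succ n ih =>
    simp only [Function.iterate_succ_apply', hf] at ih ⊢
    exact ih

lemma eq_iterate (hT : Continuous T) (n : ℕ)
    (htrans : ∃ x : X, Dense (Set.range fun j : ℕ => (T^[n + 1])^[j] x)) (k : ℕ) :
    unipotentFunctions T k = unipotentFunctions T^[n + 1] k := by
  induction k using Nat.twoStepInduction with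
  | zero => rfl
  | one =>
    refine (subset_iterate hT n 1).antisymm fun f hf => ?_
    obtain ⟨c, hc⟩ := exists_const_of_mem_one htrans hf
    exact mem_one_iff.2 ⟨hf.1, hf.2.1, fun x => by rw [hc, hc]⟩
  | more k ih₀ ih₁ =>
    refine (subset_iterate hT n (k + 2)).antisymm fun f ⟨hfc, hfn, hf⟩ => ⟨hfc, hfn, ?_⟩
    rw [← ih₁] at hf
    have hf' := hf.2.2
    rw [ih₀] at hf'
    rw [ih₁]
    refine ⟨(hfc.comp hT).mul (Complex.continuous_conj.comp hfc), fun x => by simp [hfn], ?_⟩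
    convert hf' using 2 with x
    simp only [map_mul, Complex.conj_conj, ← Function.iterate_succ_apply,
      ← Function.iterate_succ_apply' T]
    ring

end unipotentFunctions

lemma Gquasi_succ_eq_unipotentFunctions {X : Type*} [TopologicalSpace X] {T : X → X}
    (hT : Continuous T) (htrans : ∃ x : X, Dense (Set.range fun n : ℕ => T^[n] x)) (k : ℕ) :
    Gquasi T (k + 1) = unipotentFunctions T (k + 2) := by
  induction k with
  | zero =>
    ext f
    refine and_congr_right fun hfc => and_congr_right fun hfn => ⟨?_, fun hf => ?_⟩
    · rintro ⟨c, -, hc⟩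
      refine unipotentFunctions.mem_one_iff.2
        ⟨(hfc.comp hT).mul (Complex.continuous_conj.comp hfc), fun x => by simp [hfn], ?_⟩
      intro x
      exact (hc (T x)).trans (hc x).symm
    · obtain ⟨c, hc⟩ := unipotentFunctions.exists_const_of_mem_one htrans hf
      refine ⟨c, ⟨f, hfc, ?_, fun x => ?_⟩, hc⟩
      · rintro rfl
        obtain ⟨x, -⟩ := htrans
        simpa using hfn x
      · linear_combination f x * hc x - f (T x) * mul_conj_eq_one_of_norm_eq_one (hfn x)
  | succ k ih =>
    ext f
    refine and_congr_right fun _ => and_congr_right fun _ => ?_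
    rw [ih]

/-- If `T` and `T^m` (`m ≥ 2`) are both transitive continuous maps on a compact metric space,
then they have the same groups of continuous quasi-eigenfunctions of every order `k ≥ 1`. -/
theorem Gquasi_eq_of_pow
    {X : Type*} [MetricSpace X] [CompactSpace X]
    (T : X → X) (hT : Continuous T) (m : ℕ) (hm : 2 ≤ m)
    (htrans : ∃ x : X, Dense (Set.range fun n : ℕ => T^[n] x))
    (htransm : ∃ x : X, Dense (Set.range fun n : ℕ => (T^[m])^[n] x))
    (k : ℕ) (hk : 1 ≤ k) :
    Gquasi T k = Gquasi (T^[m]) k := by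
  obtain ⟨n, rfl⟩ := Nat.exists_eq_add_of_le' (one_le_two.trans hm)
  obtain ⟨j, rfl⟩ := Nat.exists_eq_add_of_le' hk
  rw [Gquasi_succ_eq_unipotentFunctions hT htrans,
    Gquasi_succ_eq_unipotentFunctions (hT.iterate _) htransm]
  exact unipotentFunctions.eq_iterate hT n htransm (j + 2)
end
end

section
/- Let (X,T) be a uniquely ergodic topological dynamical system with invariant measure μ, and let p ≥ 1 be an integer. For every continuous eigenfunction γ̃ ∈ G_1(T) (continuous, |γ̃| ≡ 1, γ̃∘T = ξ·γ̃ for some ξ ∈ 𝕊¹), there exists λ ∈ 𝕊¹ such that the skew product S : X × (𝕊¹)^p → X × (𝕊¹)^p defined by S(x, z₁, z₂, …, z_p) = (Tx, λγ̃(x)·z₁, z₁z₂, …, z_{p-1}z_p) satisfies: (1) S is uniquely ergodic (with invariant measure μ × m, m the Haar measure on (𝕊¹)^p); (2) for every integer n ≥ 1, if T^n is uniquely ergodic then S^n is uniquely ergodic. -/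
open MeasureTheory Filter

noncomputable section


/-- The circle group is endowed with its Borel σ-algebra. -/
instance : MeasurableSpace Circle := borel Circle

instance : BorelSpace Circle := ⟨rfl⟩

/-! ### Averages of orthogonal sequences -/

section Orthogonal

variable {Ω : Type*} [TopologicalSpace Ω] [CompactSpace Ω] [MeasurableSpace Ω]
  [OpensMeasurableSpace Ω]

theorem integrable_of_continuous_compactSpace {E : Type*} [NormedAddCommGroup E]
    [SecondCountableTopologyEither Ω E] {f : Ω → E} (hf : Continuous f)
    (P : Measure Ω) [IsFiniteMeasure P] : Integrable f P := by
  obtain ⟨C, hC⟩ := isCompact_univ.bddAbove_image (f := fun x => ‖f x‖) hf.norm.continuousOn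
  exact Integrable.of_bound hf.aestronglyMeasurable C
    (Eventually.of_forall fun x => hC ⟨x, Set.mem_univ _, rfl⟩)

theorem integral_norm_sq_sum_le_of_orthogonal (P : Measure Ω) [IsProbabilityMeasure P]
    (a : ℕ → Ω → ℂ) (ha : ∀ j, Continuous (a j)) (C : ℝ) (hC : ∀ j x, ‖a j x‖ ≤ C)
    (orth : ∀ i j, j < i → ∫ x, a i x * star (a j x) ∂P = 0) (N : ℕ) :
    ∫ x, ‖∑ j ∈ Finset.range N, a j x‖ ^ 2 ∂P ≤ N * C ^ 2 := by
  induction N with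
  | zero => simp
  | succ N ih =>
    have hs : Continuous fun x => ∑ j ∈ Finset.range N, a j x := by fun_prop
    have hcross : ∫ x, a N x * star (∑ j ∈ Finset.range N, a j x) ∂P = 0 := by
      simp_rw [star_sum, Finset.mul_sum]
      rw [integral_finsetSum]
      · exact Finset.sum_eq_zero fun j hj => orth N j (Finset.mem_range.1 hj)
      · intro j _
        exact integrable_of_continuous_compactSpace (by fun_prop) P
    have hre : ∫ x, (a N x * star (∑ j ∈ Finset.range N, a j x)).re ∂P = 0 := by
      have := integral_re (𝕜 := ℂ) (μ := P)
        (f := fun x => a N x * star (∑ j ∈ Finset.range N, a j x))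
        (integrable_of_continuous_compactSpace (by fun_prop) P)
      rw [hcross] at this
      simpa using this
    have hexp : ∀ x, ‖∑ j ∈ Finset.range (N + 1), a j x‖ ^ 2
        = ‖∑ j ∈ Finset.range N, a j x‖ ^ 2
          + (2 * (a N x * star (∑ j ∈ Finset.range N, a j x)).re + ‖a N x‖ ^ 2) := by
      intro x
      rw [Finset.sum_range_succ, ← Complex.normSq_eq_norm_sq, ← Complex.normSq_eq_norm_sq,
        ← Complex.normSq_eq_norm_sq, add_comm, Complex.normSq_add]
      simp only [Complex.star_def]
      ring
    have hN : ∫ x, ‖a N x‖ ^ 2 ∂P ≤ C ^ 2 := by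
      calc ∫ x, ‖a N x‖ ^ 2 ∂P ≤ ∫ _, C ^ 2 ∂P := by
            apply integral_mono
            · exact integrable_of_continuous_compactSpace (by fun_prop) P
            · exact integrable_const _
            · intro x
              exact pow_le_pow_left₀ (norm_nonneg _) (hC N x) 2
        _ = C ^ 2 := by simp
    simp_rw [hexp]
    rw [integral_add, integral_add, integral_const_mul, hre]
    · push_cast
      linarith
    all_goals exact integrable_of_continuous_compactSpace (by fun_prop) P

theorem sq_integral_norm_le (P : Measure Ω) [IsProbabilityMeasure P] {g : Ω → ℂ}
    (hg : Continuous g) : (∫ x, ‖g x‖ ∂P) ^ 2 ≤ ∫ x, ‖g x‖ ^ 2 ∂P := by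
  set c := ∫ x, ‖g x‖ ∂P with hc
  have h0 : 0 ≤ ∫ x, (‖g x‖ ^ 2 + (-(2 * c) * ‖g x‖ + c ^ 2)) ∂P := by
    refine integral_nonneg fun x => ?_
    have : ‖g x‖ ^ 2 + (-(2 * c) * ‖g x‖ + c ^ 2) = (‖g x‖ - c) ^ 2 := by ring
    simp only [this]
    positivity
  rw [integral_add, integral_add, integral_const_mul, ← hc] at h0
  · simp at h0
    nlinarith
  all_goals exact integrable_of_continuous_compactSpace (by fun_prop) P

end Orthogonal

/-! ### Averages twisted by powers of a random point of the circle -/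

theorem integral_circle_zpow (ρ : Measure Circle) [ρ.IsMulLeftInvariant] {m : ℤ} (hm : m ≠ 0) :
    ∫ z : Circle, ((z ^ m : Circle) : ℂ) ∂ρ = 0 := by
  set c : Circle := Circle.exp (Real.pi / m) with hc
  have hcm : ((c ^ m : Circle) : ℂ) = -1 := by
    have : c ^ m = Circle.exp Real.pi := by
      rw [hc, ← Circle.exp_zsmul]
      congr 1
      have : (m : ℝ) ≠ 0 := by exact_mod_cast hm
      rw [zsmul_eq_mul]
      field_simp
    rw [this]
    simp
  have h := integral_mul_left_eq_self (μ := ρ) (fun z : Circle => ((z ^ m : Circle) : ℂ)) c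
  simp_rw [mul_zpow, Circle.coe_mul, hcm] at h
  rw [integral_const_mul] at h
  linear_combination (-1 / 2 : ℂ) * h

theorem continuous_coe_circle_zpow {Y : Type*} [TopologicalSpace Y] {f : Y → Circle}
    (hf : Continuous f) (m : ℤ) : Continuous fun y => ((f y ^ m : Circle) : ℂ) :=
  continuous_induced_dom.comp (hf.zpow m)

section Twisted

variable {X : Type*} [MetricSpace X] [CompactSpace X] [MeasurableSpace X] [BorelSpace X]

theorem ae_exists_twisted_average_le (ρ : Measure Circle) [IsProbabilityMeasure ρ]
    [ρ.IsMulLeftInvariant] (μ : Measure X) [IsProbabilityMeasure μ] (b : ℕ → X → ℂ)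
    (hb : ∀ j, Continuous (b j)) (C : ℝ) (hC : ∀ j x, ‖b j x‖ ≤ C) {m : ℤ} (hm : m ≠ 0) :
    ∀ᵐ w ∂ρ, ∀ ε : ℝ, 0 < ε → ∃ N : ℕ, 0 < N ∧
      ∫ x, ‖∑ j ∈ Finset.range N, ((w ^ (m * j) : Circle) : ℂ) * b j x‖ ∂μ ≤ ε * N := by
  set Q : ℕ → Circle → ℝ := fun N w =>
    ∫ x, ‖∑ j ∈ Finset.range N, ((w ^ (m * j) : Circle) : ℂ) * b j x‖ ^ 2 ∂μ with hQ
  have hcont : ∀ N : ℕ, Continuous fun y : Circle × X =>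
      ‖∑ j ∈ Finset.range N, ((y.1 ^ (m * j) : Circle) : ℂ) * b j y.2‖ ^ 2 := by
    intro N
    refine (continuous_finsetSum _ fun j _ => ?_).norm.pow 2
    exact (continuous_coe_circle_zpow continuous_fst _).mul ((hb j).comp continuous_snd)
  have hint : ∀ N, Integrable (fun y : Circle × X =>
      ‖∑ j ∈ Finset.range N, ((y.1 ^ (m * j) : Circle) : ℂ) * b j y.2‖ ^ 2) (ρ.prod μ) :=
    fun N => integrable_of_continuous_compactSpace (hcont N) _
  have hQint : ∀ N, ∫ w, Q N w ∂ρ ≤ N * C ^ 2 := by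
    intro N
    rw [hQ, ← integral_prod _ (hint N)]
    refine integral_norm_sq_sum_le_of_orthogonal (ρ.prod μ)
      (fun j y => ((y.1 ^ (m * j) : Circle) : ℂ) * b j y.2) (fun j =>
        (continuous_coe_circle_zpow continuous_fst _).mul ((hb j).comp continuous_snd)) C
      (fun j x => by rw [norm_mul, Circle.norm_coe, one_mul]; exact hC j x.2) ?_ N
    intro i j hij
    have : ∀ y : Circle × X, ((y.1 ^ (m * i) : Circle) : ℂ) * b i y.2
          * star (((y.1 ^ (m * j) : Circle) : ℂ) * b j y.2)
        = ((y.1 ^ (m * (i - j)) : Circle) : ℂ) * (b i y.2 * star (b j y.2)) := by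
      intro y
      rw [mul_sub, zpow_sub, star_mul', Circle.coe_mul, Circle.coe_inv_eq_conj]
      simp only [Complex.star_def]
      ring
    simp_rw [this]
    rw [integral_prod_mul (fun w : Circle => ((w ^ (m * (i - j)) : Circle) : ℂ))
      (fun x => b i x * star (b j x)), integral_circle_zpow ρ, zero_mul]
    apply mul_ne_zero hm
    omega
  have key : ∀ l : ℕ, ∀ᵐ w ∂ρ, ∃ N : ℕ, 0 < N ∧ Q N w < (1 / ((l : ℝ) + 1)) ^ 2 * N ^ 2 := by
    intro l
    set δ : ℝ := (1 / ((l : ℝ) + 1)) ^ 2 with hδ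
    have hδ0 : 0 < δ := by positivity
    rw [ae_iff]
    set B := {w : Circle | ¬ ∃ N : ℕ, 0 < N ∧ Q N w < δ * N ^ 2}
    have hB : ∀ N : ℕ, 0 < N → δ * N * ρ.real B ≤ C ^ 2 := by
      intro N hN
      have hN' : (0 : ℝ) < N := by exact_mod_cast hN
      have h1 : (δ * N ^ 2) * ρ.real {w | δ * N ^ 2 ≤ Q N w} ≤ ∫ w, Q N w ∂ρ := by
        apply mul_meas_ge_le_integral_of_nonneg
        · exact Eventually.of_forall fun w => integral_nonneg fun x => by positivity
        · exact (hint N).integral_prod_left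
      have h2 : ρ.real B ≤ ρ.real {w | δ * N ^ 2 ≤ Q N w} := by
        apply measureReal_mono
        · intro w hw
          by_contra hlt
          exact hw ⟨N, hN, not_le.1 hlt⟩
        · exact measure_ne_top _ _
      have h3 : (δ * N ^ 2) * ρ.real B ≤ N * C ^ 2 :=
        (mul_le_mul_of_nonneg_left h2 (by positivity)).trans (h1.trans (hQint N))
      have : N * (δ * N * ρ.real B) ≤ N * C ^ 2 := by linarith
      exact le_of_mul_le_mul_left this hN'
    have hz : ρ.real B = 0 := by
      by_contra hne
      have hpos : 0 < ρ.real B := lt_of_le_of_ne measureReal_nonneg (Ne.symm hne)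
      obtain ⟨N, hN⟩ := exists_nat_gt (C ^ 2 / (δ * ρ.real B))
      rw [div_lt_iff₀ (by positivity)] at hN
      have h4 := hB (N + 1) (Nat.succ_pos _)
      push_cast at h4
      have : 0 < δ * ρ.real B := by positivity
      nlinarith
    rwa [measureReal_eq_zero_iff] at hz
  rw [← ae_all_iff] at key
  filter_upwards [key] with w hw ε hε
  obtain ⟨l, hl⟩ := exists_nat_one_div_lt hε
  obtain ⟨N, hN, hlt⟩ := hw l
  refine ⟨N, hN, ?_⟩
  have hsq := sq_integral_norm_le μ (g := fun x =>
    ∑ j ∈ Finset.range N, ((w ^ (m * j) : Circle) : ℂ) * b j x) (by fun_prop)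
  have h1 : (1 / ((l : ℝ) + 1)) * N ≤ ε * N :=
    mul_le_mul_of_nonneg_right hl.le (Nat.cast_nonneg _)
  refine le_trans ?_ h1
  refine abs_le_of_sq_le_sq' ?_ (by positivity) |>.2
  rw [mul_pow]
  exact hsq.trans hlt.le

end Twisted

/-! ### Characters of the torus -/

/-- The character `z ↦ ∏ i, z i ^ k i` of the torus `(𝕊¹)^p`. -/
def torusChar {p : ℕ} (k : ℕ → ℤ) (z : Fin p → Circle) : Circle := ∏ i : Fin p, z i ^ k i

theorem continuous_torusChar {p : ℕ} (k : ℕ → ℤ) :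
    Continuous (torusChar k : (Fin p → Circle) → Circle) := by
  unfold torusChar
  fun_prop

theorem continuous_mul_torusChar {X : Type*} [TopologicalSpace X] {p : ℕ} {f : X → ℂ}
    (hf : Continuous f) (k : ℕ → ℤ) :
    Continuous fun y : X × (Fin p → Circle) => f y.1 * (torusChar k y.2 : ℂ) :=
  (hf.comp continuous_fst).mul
    (continuous_induced_dom.comp ((continuous_torusChar k).comp continuous_snd))

theorem torusChar_add {p : ℕ} (k l : ℕ → ℤ) (z : Fin p → Circle) :
    torusChar (k + l) z = torusChar k z * torusChar l z := by
  simp [torusChar, zpow_add, Finset.prod_mul_distrib]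

theorem torusChar_neg {p : ℕ} (k : ℕ → ℤ) (z : Fin p → Circle) :
    torusChar (-k) z = (torusChar k z)⁻¹ := by
  simp [torusChar]

theorem torusChar_eq_one {p : ℕ} {k : ℕ → ℤ} (hk : ∀ i < p, k i = 0) (z : Fin p → Circle) :
    torusChar k z = 1 :=
  Finset.prod_eq_one fun i _ => by rw [hk i i.2, zpow_zero]

theorem integral_torusChar {p : ℕ} (ρ : Measure Circle) [IsProbabilityMeasure ρ]
    [ρ.IsMulLeftInvariant] (k : ℕ → ℤ) {r : ℕ} (hr : r < p) (hk : k r ≠ 0) :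
    ∫ z : Fin p → Circle, (torusChar k z : ℂ) ∂(Measure.pi fun _ => ρ) = 0 := by
  have : ∀ z : Fin p → Circle, (torusChar k z : ℂ) = ∏ i : Fin p, ((z i ^ k i : Circle) : ℂ) := by
    intro z
    simp only [torusChar]
    exact map_prod Circle.coeHom _ _
  simp_rw [this]
  rw [integral_fintype_prod_eq_prod (fun (i : Fin p) (w : Circle) => ((w ^ k i : Circle) : ℂ))]
  exact Finset.prod_eq_zero (Finset.mem_univ ⟨r, hr⟩) (integral_circle_zpow ρ hk)

section Determining

variable {X : Type*} [MetricSpace X] [CompactSpace X]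

open BoundedContinuousFunction in
/-- The functions `(x, z) ↦ f x * χ z`, with `f` continuous and `χ` a character of the torus. -/
def prodCharSubmonoid (X : Type*) [MetricSpace X] [CompactSpace X] (p : ℕ) :
    Submonoid (X × (Fin p → Circle) →ᵇ ℂ) where
  carrier := {F | ∃ (f : C(X, ℂ)) (k : ℕ → ℤ), (∀ i, p ≤ i → k i = 0) ∧
    ∀ y, F y = f y.1 * torusChar k y.2}
  one_mem' := ⟨1, 0, by simp, fun y => by simp [torusChar]⟩
  mul_mem' := by
    rintro F G ⟨f, k, hk, hF⟩ ⟨g, l, hl, hG⟩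
    refine ⟨f * g, k + l, fun i hi => by simp [hk i hi, hl i hi], fun y => ?_⟩
    rw [BoundedContinuousFunction.mul_apply, hF, hG, torusChar_add, Circle.coe_mul,
      ContinuousMap.mul_apply]
    ring

open BoundedContinuousFunction in
theorem star_mem_prodCharSubmonoid {p : ℕ} {F : X × (Fin p → Circle) →ᵇ ℂ}
    (hF : F ∈ prodCharSubmonoid X p) : star F ∈ prodCharSubmonoid X p := by
  obtain ⟨f, k, hk, hF⟩ := hF
  refine ⟨star f, -k, fun i hi => by simp [hk i hi], fun y => ?_⟩
  rw [BoundedContinuousFunction.star_apply, hF, torusChar_neg, Circle.coe_inv_eq_conj]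
  simp

open BoundedContinuousFunction in
theorem measure_ext_of_integral_torusChar [MeasurableSpace X] [BorelSpace X] {p : ℕ}
    (P Q : Measure (X × (Fin p → Circle)))
    [IsProbabilityMeasure P] [IsProbabilityMeasure Q]
    (h : ∀ (f : C(X, ℂ)) (k : ℕ → ℤ), (∀ i, p ≤ i → k i = 0) →
      ∫ y, f y.1 * torusChar k y.2 ∂P = ∫ y, f y.1 * torusChar k y.2 ∂Q) : P = Q := by
  set M := prodCharSubmonoid X p with hM
  have hstar : (M : Set (X × (Fin p → Circle) →ᵇ ℂ)) ∪ star (M : Set _) = M := by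
    apply Set.union_eq_self_of_subset_right
    intro F hF
    rw [Set.mem_star] at hF
    simpa using star_mem_prodCharSubmonoid hF
  refine ext_of_forall_mem_subalgebra_integral_eq_of_pseudoEMetric_complete_countable
    (𝕜 := ℂ) (A := StarAlgebra.adjoin ℂ (M : Set _)) ?_ ?_
  · rintro ⟨x, z⟩ ⟨x', z'⟩ hne
    have hmem : ∀ F ∈ M, (fun y => F y) ∈ Set.image
        (fun f : C(X × (Fin p → Circle), ℂ) => (f : _ → ℂ))
        (((StarAlgebra.adjoin ℂ (M : Set (X × (Fin p → Circle) →ᵇ ℂ))).map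
          (toContinuousMapStarₐ ℂ) : StarSubalgebra ℂ C(X × (Fin p → Circle), ℂ)) :
            Set C(X × (Fin p → Circle), ℂ)) := by
      intro F hF
      exact ⟨toContinuousMapStarₐ ℂ F, ⟨F, StarAlgebra.subset_adjoin ℂ _ hF, rfl⟩, rfl⟩
    by_cases hx : x = x'
    · have hz : z ≠ z' := fun hz => hne (by rw [hx, hz])
      obtain ⟨i, hi⟩ := Function.ne_iff.1 hz
      refine ⟨_, hmem (mkOfCompact ⟨fun y : X × (Fin p → Circle) => (y.2 i : ℂ), by fun_prop⟩)
        ⟨1, Pi.single (i : ℕ) 1, ?_, ?_⟩, ?_⟩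
      · intro j hj
        exact Pi.single_eq_of_ne (by have := i.2; omega) _
      · intro y
        have : torusChar (Pi.single (i : ℕ) 1) y.2 = y.2 i := by
          rw [torusChar, Finset.prod_eq_single i]
          · simp
          · intro j _ hj
            rw [Pi.single_eq_of_ne (by rwa [Ne, Fin.val_inj]), zpow_zero]
          · simp
        simp [this]
      · exact fun h => hi (Circle.ext h)
    · refine ⟨_, hmem (mkOfCompact ⟨fun y : X × (Fin p → Circle) => (dist y.1 x : ℂ), by fun_prop⟩)
        ⟨⟨fun y => (dist y x : ℂ), by fun_prop⟩, 0, by simp, fun y => by simp [torusChar]⟩, ?_⟩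
      simpa [eq_comm] using hx
  · intro F hF
    have hF' : F ∈ Submodule.span ℂ (M : Set (X × (Fin p → Circle) →ᵇ ℂ)) := by
      have := StarAlgebra.adjoin_eq_span (R := ℂ) (M : Set (X × (Fin p → Circle) →ᵇ ℂ))
      rw [hstar, Submonoid.closure_eq] at this
      rw [← this]
      exact hF
    clear hF
    induction hF' using Submodule.span_induction with
    | mem F hmem =>
      obtain ⟨f, k, hk, hfk⟩ := hmem
      simp_rw [hfk]
      exact h f k hk
    | zero => simp
    | add F G _ _ hF hG =>
      simp only [BoundedContinuousFunction.add_apply]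
      rw [integral_add (F.integrable P) (G.integrable P),
        integral_add (F.integrable Q) (G.integrable Q), hF, hG]
    | smul c F _ hF =>
      simp only [BoundedContinuousFunction.smul_apply, integral_smul, hF]

end Determining

/-! ### Invariant measures and orthogonality of orbits -/

section Invariant

variable {Ω : Type*} [TopologicalSpace Ω] [MeasurableSpace Ω] [BorelSpace Ω]

theorem integral_comp_iterate_of_map_eq {ν : Measure Ω} {g : Ω → Ω} (hg : Continuous g)
    (hν : Measure.map g ν = ν) {F : Ω → ℂ} (hF : Continuous F) (j : ℕ) :
    ∫ y, F (g^[j] y) ∂ν = ∫ y, F y ∂ν := by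
  have hmp : MeasurePreserving (g^[j]) ν ν := MeasurePreserving.iterate ⟨hg.measurable, hν⟩ j
  conv_rhs => rw [← hmp.map_eq]
  rw [integral_map hmp.measurable.aemeasurable hF.aestronglyMeasurable]

theorem integral_sum_iterate_of_map_eq [CompactSpace Ω] {ν : Measure Ω} [IsFiniteMeasure ν]
    {g : Ω → Ω} (hg : Continuous g) (hν : Measure.map g ν = ν) {F : Ω → ℂ} (hF : Continuous F)
    (N : ℕ) : ∫ y, ∑ j ∈ Finset.range N, F (g^[j] y) ∂ν = N * ∫ y, F y ∂ν := by
  have hcont : ∀ j, Continuous fun y => F (g^[j] y) := fun j => hF.comp (hg.iterate j)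
  rw [integral_finsetSum _ fun j _ => integrable_of_continuous_compactSpace (hcont j) ν]
  simp_rw [integral_comp_iterate_of_map_eq hg hν hF]
  simp

/-- If `F` is orthogonal to its translates along the orbit of `g`, then its integral vanishes. -/
theorem integral_eq_zero_of_orthogonal_iterates [CompactSpace Ω] {ν : Measure Ω}
    [IsProbabilityMeasure ν] {g : Ω → Ω} (hg : Continuous g) (hν : Measure.map g ν = ν)
    {F : Ω → ℂ} (hF : Continuous F)
    (horth : ∀ j, 0 < j → ∫ y, F (g^[j] y) * star (F y) ∂ν = 0) : ∫ y, F y ∂ν = 0 := by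
  obtain ⟨C, hC⟩ := isCompact_univ.bddAbove_image (f := fun x => ‖F x‖) hF.norm.continuousOn
  have hC' : ∀ x, ‖F x‖ ≤ C := fun x => hC ⟨x, Set.mem_univ _, rfl⟩
  have hcont : ∀ j, Continuous fun y => F (g^[j] y) := fun j => hF.comp (hg.iterate j)
  set I := ∫ y, F y ∂ν with hI
  have hbound : ∀ N : ℕ, (N * ‖I‖) ^ 2 ≤ N * C ^ 2 := by
    intro N
    have h1 := integral_norm_sq_sum_le_of_orthogonal ν (fun j y => F (g^[j] y)) hcont C
      (fun j x => hC' _) (fun i j hij => by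
        have hrw : ∀ y, F (g^[i] y) * star (F (g^[j] y))
            = (fun w => F (g^[i - j] w) * star (F w)) (g^[j] y) := by
          intro y
          simp only [← Function.iterate_add_apply, Nat.sub_add_cancel hij.le]
        simp_rw [hrw]
        exact (integral_comp_iterate_of_map_eq hg hν (F := fun w => F (g^[i - j] w) * star (F w))
          ((hcont _).mul hF.star) j).trans (horth _ (Nat.sub_pos_of_lt hij))) N
    have h2 := sq_integral_norm_le ν (g := fun y => ∑ j ∈ Finset.range N, F (g^[j] y))
      (continuous_finsetSum _ fun j _ => hcont j)
    have h4 : N * ‖I‖ ≤ ∫ y, ‖∑ j ∈ Finset.range N, F (g^[j] y)‖ ∂ν := by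
      have := norm_integral_le_integral_norm (μ := ν)
        (fun y => ∑ j ∈ Finset.range N, F (g^[j] y))
      rw [integral_sum_iterate_of_map_eq hg hν hF, ← hI] at this
      simpa using this
    exact (pow_le_pow_left₀ (by positivity) h4 2).trans (h2.trans h1)
  by_contra hne
  have hpos : 0 < ‖I‖ ^ 2 := by positivity
  obtain ⟨N, hN⟩ := exists_nat_gt (C ^ 2 / ‖I‖ ^ 2)
  rw [div_lt_iff₀ hpos] at hN
  have h5 := hbound (N + 1)
  have h6 : ((N + 1 : ℕ) : ℝ) * (((N + 1 : ℕ) : ℝ) * ‖I‖ ^ 2) ≤ ((N + 1 : ℕ) : ℝ) * C ^ 2 := by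
    linarith [h5]
  have h7 := le_of_mul_le_mul_left h6 (by positivity)
  push_cast at h7
  linarith

end Invariant

/-! ### The skew product and its action on characters -/

/-- The transpose of the unipotent automorphism `z ↦ (z₁, z₁z₂, …, z_{p-1}z_p)`. -/
def charShift (k : ℕ → ℤ) : ℕ → ℤ := fun i => k i + k (i + 1)

theorem charShift_iterate_of_lt {k : ℕ → ℤ} {r : ℕ} (hk : ∀ i, r < i → k i = 0) (m : ℕ) :
    (∀ i, r < i → charShift^[m] k i = 0) ∧ charShift^[m] k r = k r := by
  induction m with
  | zero => exact ⟨hk, rfl⟩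
  | succ m ih =>
    simp only [Function.iterate_succ_apply', charShift]
    exact ⟨fun i hi => by rw [ih.1 i hi, ih.1 _ (by omega), add_zero],
      by rw [ih.2, ih.1 _ (Nat.lt_succ_self r), add_zero]⟩

theorem charShift_iterate_pred {k : ℕ → ℤ} {r : ℕ} (hk : ∀ i, r + 1 < i → k i = 0) (m : ℕ) :
    charShift^[m] k r = k r + m * k (r + 1) := by
  induction m with
  | zero => simp
  | succ m ih =>
    simp only [Function.iterate_succ_apply', charShift]
    rw [ih, (charShift_iterate_of_lt hk m).2]
    push_cast
    ring

section Skew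

variable {X : Type*}

/-- The skew product `(x, z) ↦ (T x, lam * γ x * z₁, z₁z₂, …, z_{p-1}z_p)`. -/
def skewProduct (T : X → X) (γ : X → Circle) (lam : Circle) (p : ℕ)
    (y : X × (Fin p → Circle)) : X × (Fin p → Circle) :=
  (T y.1, fun i : Fin p => if (i : ℕ) = 0 then lam * γ y.1 * y.2 i
    else y.2 ⟨(i : ℕ) - 1, Nat.lt_of_le_of_lt (Nat.sub_le _ _) i.isLt⟩ * y.2 i)

theorem skewProduct_iterate_fst (T : X → X) (γ : X → Circle) (lam : Circle) (p : ℕ)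
    (y : X × (Fin p → Circle)) (m : ℕ) : ((skewProduct T γ lam p)^[m] y).1 = T^[m] y.1 := by
  induction m with
  | zero => rfl
  | succ m ih => rw [Function.iterate_succ_apply', Function.iterate_succ_apply', ← ih]; rfl

theorem continuous_skewProduct [TopologicalSpace X] {T : X → X} (hT : Continuous T)
    {γ : X → Circle} (hγ : Continuous γ) (lam : Circle) (p : ℕ) :
    Continuous (skewProduct T γ lam p) := by
  unfold skewProduct
  refine (hT.comp continuous_fst).prodMk (continuous_pi fun i => ?_)
  split_ifs <;> fun_prop

theorem torusChar_skewProduct (T : X → X) (γ : X → Circle) (lam : Circle) {p : ℕ} {k : ℕ → ℤ}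
    (hk : ∀ i, p ≤ i → k i = 0) (y : X × (Fin p → Circle)) :
    torusChar k (skewProduct T γ lam p y).2
      = (lam * γ y.1) ^ k 0 * torusChar (charShift k) y.2 := by
  cases p with
  | zero => simp [torusChar, hk 0 le_rfl]
  | succ q =>
    simp only [torusChar, charShift, skewProduct, zpow_add, Finset.prod_mul_distrib]
    rw [Fin.prod_univ_succ, Fin.prod_univ_succ (fun i : Fin (q + 1) => y.2 i ^ k i),
      Fin.prod_univ_castSucc (fun i : Fin (q + 1) => y.2 i ^ k (i + 1))]
    simp only [Fin.val_zero, Fin.val_succ, Fin.val_castSucc, Fin.val_last, if_true,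
      Nat.succ_ne_zero, if_false, Nat.add_sub_cancel, hk (q + 1) le_rfl, zpow_zero, mul_one,
      mul_zpow, Finset.prod_mul_distrib]
    have : ∀ i : Fin q, (⟨(i : ℕ), Nat.lt_succ_of_lt i.2⟩ : Fin (q + 1)) = i.castSucc :=
      fun i => rfl
    simp only [this, mul_assoc, mul_left_comm, mul_comm]

theorem exists_torusChar_skewProduct_iterate [TopologicalSpace X] {T : X → X}
    (hT : Continuous T) {γ : X → Circle} (hγ : Continuous γ) (lam : Circle) {p : ℕ} (m : ℕ)
    {k : ℕ → ℤ} (hk : ∀ i, p ≤ i → k i = 0) :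
    ∃ g : X → Circle, Continuous g ∧ ∀ y : X × (Fin p → Circle),
      torusChar k ((skewProduct T γ lam p)^[m] y).2
        = g y.1 * torusChar (charShift^[m] k) y.2 := by
  induction m generalizing k with
  | zero => exact ⟨fun _ => 1, continuous_const, fun y => by simp⟩
  | succ m ih =>
    obtain ⟨g, hg, hgk⟩ := ih (k := charShift k)
      (fun i hi => by simp [charShift, hk i hi, hk (i + 1) (by omega)])
    refine ⟨fun x => (lam * γ (T^[m] x)) ^ k 0 * g x, ?_, fun y => ?_⟩
    · exact ((continuous_const.mul (hγ.comp (hT.iterate m))).zpow _).mul hg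
    · rw [Function.iterate_succ_apply', torusChar_skewProduct T γ lam hk, hgk,
        skewProduct_iterate_fst, Function.iterate_succ_apply, mul_assoc]

theorem torusChar_skewProduct_iterate_of_degree_zero (T : X → X) (γ : X → Circle)
    (lam : Circle) {p : ℕ} (hp : 0 < p) {k : ℕ → ℤ} (hk : ∀ i, 0 < i → k i = 0)
    (y : X × (Fin p → Circle)) (m : ℕ) :
    torusChar k ((skewProduct T γ lam p)^[m] y).2
      = lam ^ (k 0 * m) * (∏ i ∈ Finset.range m, γ (T^[i] y.1)) ^ k 0 * torusChar k y.2 := by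
  have hshift : charShift k = k := by
    funext i
    simp [charShift, hk (i + 1) (Nat.succ_pos i)]
  induction m with
  | zero => simp
  | succ m ih =>
    rw [Function.iterate_succ_apply', torusChar_skewProduct T γ lam
      (fun i hi => hk i (by omega)), hshift, ih, skewProduct_iterate_fst,
      Finset.prod_range_succ, mul_zpow, mul_zpow]
    push_cast
    rw [mul_add, mul_one, zpow_add]
    simp only [mul_assoc, mul_left_comm, mul_comm]

end Skew

/-! ### Unique ergodicity of the skew product -/

section UniqueErgodicity

variable {X : Type*} [MetricSpace X] [CompactSpace X] [MeasurableSpace X] [BorelSpace X]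

/-- For the functions `f` of a dense sequence, the averages of `f` twisted by the cocycle
`lam ^ (m * n * j) * (∏ i < n * j, γ (T^i x)) ^ m` are small in `L¹(μ)` along some times. -/
def HasSmallTwistedAverages (T : X → X) (γ : X → Circle) (μ : Measure X) (n : ℕ)
    (lam : Circle) : Prop :=
  ∀ (m : ℤ), m ≠ 0 → ∀ (l : ℕ) (ε : ℝ), 0 < ε → ∃ N : ℕ, 0 < N ∧
    ∫ x, ‖∑ j ∈ Finset.range N, ((lam ^ (m * n * j) : Circle) : ℂ) *
      (TopologicalSpace.denseSeq C(X, ℂ) l (T^[n * j] x) *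
        (((∏ i ∈ Finset.range (n * j), γ (T^[i] x)) ^ m : Circle) : ℂ))‖ ∂μ ≤ ε * N

theorem ae_hasSmallTwistedAverages (ρ : Measure Circle) [IsProbabilityMeasure ρ]
    [ρ.IsMulLeftInvariant] {T : X → X} (hT : Continuous T) {γ : X → Circle} (hγ : Continuous γ)
    (μ : Measure X) [IsProbabilityMeasure μ] {n : ℕ} (hn : 0 < n) :
    ∀ᵐ lam ∂ρ, HasSmallTwistedAverages T γ μ n lam := by
  unfold HasSmallTwistedAverages
  refine ae_all_iff.2 fun m => ?_
  by_cases hm : m = 0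
  · simp [hm]
  · simp only [ne_eq, hm, not_false_eq_true, forall_const]
    refine ae_all_iff.2 fun l => ?_
    refine ae_exists_twisted_average_le ρ μ (fun j x =>
      TopologicalSpace.denseSeq C(X, ℂ) l (T^[n * j] x) *
        (((∏ i ∈ Finset.range (n * j), γ (T^[i] x)) ^ m : Circle) : ℂ)) (fun j => ?_)
      ‖TopologicalSpace.denseSeq C(X, ℂ) l‖ (fun j x => ?_)
      (mul_ne_zero hm (by exact_mod_cast hn.ne'))
    · exact ((ContinuousMap.continuous _).comp (hT.iterate _)).mul
        (continuous_coe_circle_zpow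
          (continuous_finsetProd _ fun i _ => hγ.comp (hT.iterate i)) m)
    · rw [norm_mul, Circle.norm_coe, mul_one]
      exact ContinuousMap.norm_coe_le_norm _ _

variable {T : X → X} {γ : X → Circle} {lam : Circle} {p n : ℕ} {μ : Measure X}
  {ν : Measure (X × (Fin p → Circle))}

theorem integral_torusChar_eq_zero_of_degree_zero [IsProbabilityMeasure ν]
    (hT : Continuous T) (hγ : Continuous γ) (hp : 0 < p)
    (hlam : HasSmallTwistedAverages T γ μ n lam)
    (hν : Measure.map (skewProduct T γ lam p)^[n] ν = ν) (hμ : Measure.map Prod.fst ν = μ)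
    {k : ℕ → ℤ} (hk0 : k 0 ≠ 0) (hk : ∀ i, 0 < i → k i = 0) (f : C(X, ℂ)) :
    ∫ y, f y.1 * (torusChar k y.2 : ℂ) ∂ν = 0 := by
  have hS := (continuous_skewProduct hT hγ lam p).iterate n
  have hdense : ∀ l : ℕ, ∫ y, TopologicalSpace.denseSeq C(X, ℂ) l y.1 *
      (torusChar k y.2 : ℂ) ∂ν = 0 := by
    intro l
    set f := TopologicalSpace.denseSeq C(X, ℂ) l with hf
    set I := ∫ y, f y.1 * (torusChar k y.2 : ℂ) ∂ν with hI
    rw [← norm_le_zero_iff]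
    refine le_of_forall_pos_le_add fun ε hε => ?_
    rw [zero_add]
    obtain ⟨N, hN, hle⟩ := hlam (k 0) hk0 l ε hε
    rw [← hf] at hle
    set A : X → ℂ := fun x => ∑ j ∈ Finset.range N, ((lam ^ (k 0 * n * j) : Circle) : ℂ) *
      (f (T^[n * j] x) * (((∏ i ∈ Finset.range (n * j), γ (T^[i] x)) ^ k 0 : Circle) : ℂ))
      with hA
    have hAcont : Continuous A := by
      refine continuous_finsetSum _ fun j _ => continuous_const.mul ?_
      exact (f.continuous.comp (hT.iterate _)).mul (continuous_coe_circle_zpow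
        (continuous_finsetProd _ fun i _ => hγ.comp (hT.iterate i)) _)
    have hcont := continuous_mul_torusChar (p := p) f.continuous k
    have h1 : (N : ℂ) * I = ∫ y, A y.1 * (torusChar k y.2 : ℂ) ∂ν := by
      have h2 : ∀ y, A y.1 * (torusChar k y.2 : ℂ) = ∑ j ∈ Finset.range N,
          (fun y : X × (Fin p → Circle) => f y.1 * (torusChar k y.2 : ℂ))
            (((skewProduct T γ lam p)^[n])^[j] y) := by
        intro y
        rw [hA, Finset.sum_mul]
        refine Finset.sum_congr rfl fun j _ => ?_
        rw [← Function.iterate_mul]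
        simp only [skewProduct_iterate_fst,
          torusChar_skewProduct_iterate_of_degree_zero T γ lam hp hk, Circle.coe_mul]
        push_cast
        rw [← mul_assoc (k 0)]
        ring
      rw [hI, ← integral_sum_iterate_of_map_eq hS hν hcont N]
      exact integral_congr_ae (Eventually.of_forall fun y => (h2 y).symm)
    have h3 : N * ‖I‖ ≤ ∫ x, ‖A x‖ ∂μ := by
      have h4 := norm_integral_le_integral_norm (μ := ν)
        (fun y : X × (Fin p → Circle) => A y.1 * (torusChar k y.2 : ℂ))
      rw [← h1] at h4
      simp only [norm_mul, Circle.norm_coe, mul_one, Complex.norm_natCast] at h4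
      rwa [← hμ, integral_map measurable_fst.aemeasurable hAcont.norm.aestronglyMeasurable]
    have hN' : (0 : ℝ) < N := by exact_mod_cast hN
    have h5 : N * ‖I‖ ≤ N * ε := by linarith
    exact le_of_mul_le_mul_left h5 hN'
  rw [← norm_le_zero_iff]
  refine le_of_forall_pos_le_add fun ε hε => ?_
  rw [zero_add]
  obtain ⟨l, hl⟩ := (TopologicalSpace.denseRange_denseSeq C(X, ℂ)).exists_dist_lt f hε
  rw [← sub_zero (∫ y, f y.1 * (torusChar k y.2 : ℂ) ∂ν), ← hdense l, ← integral_sub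
    (integrable_of_continuous_compactSpace (continuous_mul_torusChar f.continuous k) ν)
    (integrable_of_continuous_compactSpace
      (continuous_mul_torusChar (ContinuousMap.continuous _) k) ν)]
  refine (norm_integral_le_of_norm_le_const (C := ε) (Eventually.of_forall fun y => ?_)).trans
    (by simp)
  rw [← sub_mul, norm_mul, Circle.norm_coe, mul_one, ← dist_eq_norm]
  exact (ContinuousMap.dist_apply_le_dist _).trans hl.le

theorem integral_torusChar_eq_zero [IsProbabilityMeasure ν]
    (hT : Continuous T) (hγ : Continuous γ) (hn : 0 < n)
    (hlam : HasSmallTwistedAverages T γ μ n lam)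
    (hν : Measure.map (skewProduct T γ lam p)^[n] ν = ν) (hμ : Measure.map Prod.fst ν = μ)
    {r : ℕ} (hr : r < p) {k : ℕ → ℤ} (hkr : k r ≠ 0) (hk : ∀ i, r < i → k i = 0) (f : C(X, ℂ)) :
    ∫ y, f y.1 * (torusChar k y.2 : ℂ) ∂ν = 0 := by
  induction r generalizing k f with
  | zero => exact integral_torusChar_eq_zero_of_degree_zero hT hγ hr hlam hν hμ hkr hk f
  | succ r ih =>
    have hS := (continuous_skewProduct hT hγ lam p).iterate n
    refine integral_eq_zero_of_orthogonal_iterates hS hν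
      (continuous_mul_torusChar f.continuous k) fun j hj => ?_
    obtain ⟨g, hg, hgk⟩ := exists_torusChar_skewProduct_iterate hT hγ lam (p := p) (n * j)
      (fun i hi => hk i (by omega))
    have hrw : ∀ y : X × (Fin p → Circle),
        f (((skewProduct T γ lam p)^[n])^[j] y).1 *
            (torusChar k (((skewProduct T γ lam p)^[n])^[j] y).2 : ℂ) *
          star (f y.1 * (torusChar k y.2 : ℂ))
        = (⟨fun x => f (T^[n * j] x) * (g x : ℂ) * star (f x),
            ((f.continuous.comp (hT.iterate _)).mul (continuous_induced_dom.comp hg)).mul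
              f.continuous.star⟩ : C(X, ℂ)) y.1 *
          (torusChar (charShift^[n * j] k + -k) y.2 : ℂ) := by
      intro y
      rw [← Function.iterate_mul, skewProduct_iterate_fst, hgk, torusChar_add, torusChar_neg,
        Circle.coe_mul, Circle.coe_mul, Circle.coe_inv_eq_conj]
      simp only [ContinuousMap.coe_mk, Complex.star_def, map_mul]
      ring
    simp_rw [hrw]
    refine ih (by omega) ?_ (fun i hi => ?_) _
    · rw [Pi.add_apply, Pi.neg_apply, charShift_iterate_pred hk]
      have : ((n * j : ℕ) : ℤ) ≠ 0 := by exact_mod_cast (Nat.mul_pos hn hj).ne'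
      rw [add_neg_cancel_comm]
      exact mul_ne_zero this hkr
    · obtain ⟨h1, h2⟩ := charShift_iterate_of_lt hk (n * j)
      rw [Pi.add_apply, Pi.neg_apply]
      rcases (Nat.succ_le_of_lt hi).eq_or_lt with h | h
      · rw [← h, h2, add_neg_cancel]
      · rw [h1 i h, hk i h, neg_zero, add_zero]

theorem eq_zero_or_exists_degree {p : ℕ} {k : ℕ → ℤ} (hk : ∀ i, p ≤ i → k i = 0) :
    k = 0 ∨ ∃ r < p, k r ≠ 0 ∧ ∀ i, r < i → k i = 0 := by
  induction p with
  | zero => exact Or.inl (funext fun i => hk i (Nat.zero_le i))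
  | succ p ih =>
    by_cases h : k p = 0
    · rcases ih (fun i hi => by
        rcases hi.eq_or_lt with rfl | hi
        · exact h
        · exact hk i hi) with h | ⟨r, hr, h⟩
      · exact Or.inl h
      · exact Or.inr ⟨r, by omega, h⟩
    · exact Or.inr ⟨p, by omega, h, fun i hi => hk i hi⟩

theorem integral_prod_torusChar [IsProbabilityMeasure μ] (ρ : Measure Circle)
    [IsProbabilityMeasure ρ] [ρ.IsMulLeftInvariant] {r : ℕ} (hr : r < p) {k : ℕ → ℤ}
    (hkr : k r ≠ 0) (f : X → ℂ) :
    ∫ y, f y.1 * (torusChar k y.2 : ℂ) ∂(μ.prod (Measure.pi fun _ : Fin p => ρ)) = 0 := by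
  rw [integral_prod_mul f (fun z : Fin p → Circle => (torusChar k z : ℂ)),
    integral_torusChar ρ k hr hkr, mul_zero]

theorem map_skewProduct_prod [IsProbabilityMeasure μ] (ρ : Measure Circle)
    [IsProbabilityMeasure ρ] [ρ.IsMulLeftInvariant] (hT : Continuous T) (hγ : Continuous γ)
    (hTμ : Measure.map T μ = μ) :
    Measure.map (skewProduct T γ lam p) (μ.prod (Measure.pi fun _ => ρ))
      = μ.prod (Measure.pi fun _ => ρ) := by
  have hS := continuous_skewProduct hT hγ lam p
  have := Measure.isProbabilityMeasure_map (μ := μ.prod (Measure.pi fun _ : Fin p => ρ))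
    hS.measurable.aemeasurable
  refine measure_ext_of_integral_torusChar _ _ fun f k hk => ?_
  rw [integral_map hS.measurable.aemeasurable
    (continuous_mul_torusChar f.continuous k).aestronglyMeasurable]
  rcases eq_zero_or_exists_degree hk with rfl | ⟨r, hr, hkr, hk'⟩
  · simp only [torusChar_eq_one (k := 0) (fun _ _ => rfl), Circle.coe_one]
    rw [integral_prod_mul f (fun _ : Fin p → Circle => (1 : ℂ))]
    have : ∀ y : X × (Fin p → Circle), (skewProduct T γ lam p y).1 = T y.1 := fun y => rfl
    simp_rw [this]
    rw [integral_prod_mul (fun x => f (T x)) (fun _ : Fin p → Circle => (1 : ℂ))]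
    congr 1
    conv_rhs => rw [← hTμ]
    rw [integral_map hT.measurable.aemeasurable f.continuous.aestronglyMeasurable]
  · have hrw : ∀ y : X × (Fin p → Circle), f (skewProduct T γ lam p y).1 *
        (torusChar k (skewProduct T γ lam p y).2 : ℂ)
        = (fun x => f (T x) * (((lam * γ x) ^ k 0 : Circle) : ℂ)) y.1 *
          (torusChar (charShift k) y.2 : ℂ) := by
      intro y
      rw [torusChar_skewProduct T γ lam hk, Circle.coe_mul]
      simp only [skewProduct]
      ring
    simp_rw [hrw]
    rw [integral_prod_torusChar ρ hr hkr]
    refine integral_prod_torusChar (μ := μ) ρ hr ?_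
      (fun x => f (T x) * (((lam * γ x) ^ k 0 : Circle) : ℂ))
    have := (charShift_iterate_of_lt hk' 1).2
    simp only [Function.iterate_one] at this
    rwa [this]

theorem existsUnique_invariant_skewProduct_iterate [IsProbabilityMeasure μ] (ρ : Measure Circle)
    [IsProbabilityMeasure ρ] [ρ.IsMulLeftInvariant] (hT : Continuous T) (hγ : Continuous γ)
    (hn : 0 < n) (hTμ : Measure.map T μ = μ)
    (hunique : ∀ κ : Measure X, IsProbabilityMeasure κ → Measure.map T^[n] κ = κ → κ = μ)
    (hlam : HasSmallTwistedAverages T γ μ n lam) :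
    ∃! ν : Measure (X × (Fin p → Circle)),
      IsProbabilityMeasure ν ∧ Measure.map (skewProduct T γ lam p)^[n] ν = ν := by
  have hS := continuous_skewProduct hT hγ lam p
  refine ⟨μ.prod (Measure.pi fun _ => ρ), ⟨inferInstance, ?_⟩, ?_⟩
  · exact (MeasurePreserving.iterate
      ⟨hS.measurable, map_skewProduct_prod ρ hT hγ hTμ⟩ n).map_eq
  · rintro ν ⟨hprob, hν⟩
    have hμ : Measure.map Prod.fst ν = μ := by
      refine hunique _ (Measure.isProbabilityMeasure_map measurable_fst.aemeasurable) ?_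
      conv_rhs => rw [← hν]
      rw [Measure.map_map (hT.iterate n).measurable measurable_fst,
        Measure.map_map measurable_fst (hS.iterate n).measurable]
      congr 1
      funext y
      exact (skewProduct_iterate_fst T γ lam p y n).symm
    refine measure_ext_of_integral_torusChar _ _ fun f k hk => ?_
    rcases eq_zero_or_exists_degree hk with rfl | ⟨r, hr, hkr, hk'⟩
    · simp only [torusChar_eq_one (k := 0) (fun _ _ => rfl), Circle.coe_one, mul_one]
      rw [← integral_map (φ := Prod.fst) measurable_fst.aemeasurable
          f.continuous.aestronglyMeasurable, hμ,
        ← integral_map (φ := Prod.fst) measurable_fst.aemeasurable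
          f.continuous.aestronglyMeasurable, Measure.map_fst_prod]
      simp
    · rw [integral_prod_torusChar ρ hr hkr]
      exact integral_torusChar_eq_zero hT hγ hn hlam hν hμ hr hkr hk' f

end UniqueErgodicity

/-- **Extension of unique ergodicity** (Lemma 3.2). Given a uniquely ergodic system `(X,T)`
and a continuous eigenfunction `γ̃ : X → 𝕊¹` (with eigenvalue `ξ`), there exists `λ ∈ 𝕊¹`
such that the skew product
`S(x, z₁, …, z_p) = (Tx, λγ̃(x)z₁, z₁z₂, …, z_{p-1}z_p)` on `X × (𝕊¹)^p` is uniquely ergodic,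
and moreover `Sⁿ` is uniquely ergodic whenever `Tⁿ` is, for every `n ≥ 1`. -/
theorem skew_product_uniquely_ergodic
    {X : Type*} [MetricSpace X] [CompactSpace X] [MeasurableSpace X] [BorelSpace X]
    (T : X → X) (hT : Continuous T)
    (hue : ∃! ν : Measure X, IsProbabilityMeasure ν ∧ Measure.map T ν = ν)
    (p : ℕ) (hp : 1 ≤ p)
    (γ : X → Circle) (hγc : Continuous γ) (ξ : Circle) (hξ : ∀ x, γ (T x) = ξ * γ x) :
    ∃ lam : Circle, ∀ S : X × (Fin p → Circle) → X × (Fin p → Circle),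
      (∀ (x : X) (z : Fin p → Circle), S (x, z) = (T x, fun i : Fin p =>
          if (i : ℕ) = 0 then lam * γ x * z i
          else z ⟨(i : ℕ) - 1, Nat.lt_of_le_of_lt (Nat.sub_le _ _) i.isLt⟩ * z i)) →
      (∃! ν : Measure (X × (Fin p → Circle)),
          IsProbabilityMeasure ν ∧ Measure.map S ν = ν) ∧
      (∀ n : ℕ, 1 ≤ n →
        (∃! ν : Measure X, IsProbabilityMeasure ν ∧ Measure.map (T^[n]) ν = ν) →
        (∃! ν : Measure (X × (Fin p → Circle)),
          IsProbabilityMeasure ν ∧ Measure.map (S^[n]) ν = ν)) := by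
  obtain ⟨μ, ⟨hμprob, hTμ⟩, hμuniq⟩ := hue
  set ρ := Measure.haarMeasure (⊤ : TopologicalSpace.PositiveCompacts Circle) with hρ
  have hρprob : IsProbabilityMeasure ρ :=
    ⟨by simpa using Measure.haarMeasure_self (K₀ := (⊤ : TopologicalSpace.PositiveCompacts Circle))⟩
  have hae : ∀ᵐ lam ∂ρ, ∀ n : ℕ, HasSmallTwistedAverages T γ μ (n + 1) lam :=
    ae_all_iff.2 fun n => ae_hasSmallTwistedAverages ρ hT hγc μ (Nat.succ_pos n)
  obtain ⟨lam, hlam⟩ := hae.exists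
  refine ⟨lam, fun S hS => ?_⟩
  obtain rfl : S = skewProduct T γ lam p := funext fun y => hS y.1 y.2
  refine ⟨existsUnique_invariant_skewProduct_iterate (n := 1) ρ hT hγc one_pos hTμ
    (fun κ h1 h2 => hμuniq κ ⟨h1, h2⟩) (hlam 0), fun n hn hne => ?_⟩
  obtain ⟨n, rfl⟩ := Nat.exists_eq_succ_of_ne_zero (Nat.one_le_iff_ne_zero.1 hn)
  refine existsUnique_invariant_skewProduct_iterate ρ hT hγc hn hTμ (fun κ h1 h2 => ?_) (hlam n)
  exact hne.unique ⟨h1, h2⟩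
    ⟨hμprob, (MeasurePreserving.iterate ⟨hT.measurable, hTμ⟩ (n + 1)).map_eq⟩
end
end
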